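/- arXiv:2408.03787 — 5 statements merged into one kernel-verified Lean document; each statement's English description precedes it below -/
import Mathlib

section
/- Let r₀ > 0 and C ≥ 0, let u : ℝ³ → ℝ be differentiable at every point of the region {x ∈ ℝ³ : ‖x‖ ≥ r₀} with ‖∇u(x)‖ ≤ C/‖x‖² for all ‖x‖ ≥ r₀, and let e ∈ ℝ³ be a fixed unit vector such that u(r·e) → 0 as r → ∞. Then u(x) → 0 as ‖x‖ → ∞; in particular, sup_{‖x‖ = r} |u(x)| → 0 as r → ∞. -/
open Real Filter
open scoped Topology

section GradientDecay

variable {E : Type*} [NormedAddCommGroup E] [InnerProductSpace ℝ E]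

theorem norm_gradient_eq_norm_fderiv [CompleteSpace E] (u : E → ℝ) (x : E) :
    ‖gradient u x‖ = ‖fderiv ℝ u x‖ := by
  simp [gradient]

/-- The chord between two points of a sphere at an angle of at most `π / 2` stays away from the
centre. -/
theorem half_le_norm_of_mem_segment {r : ℝ} {x y z : E} (hx : ‖x‖ = r) (hy : ‖y‖ = r)
    (hxy : 0 ≤ inner ℝ x y) (hz : z ∈ segment ℝ x y) : r / 2 ≤ ‖z‖ := by
  obtain ⟨a, b, ha, hb, hab, rfl⟩ := hz
  have hsq : ‖a • x + b • y‖ ^ 2 = (a ^ 2 + b ^ 2) * r ^ 2 + 2 * (a * b) * inner ℝ x y := by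
    rw [norm_add_sq_real, norm_smul, norm_smul, real_inner_smul_left, real_inner_smul_right,
      hx, hy, Real.norm_eq_abs, Real.norm_eq_abs, mul_pow, mul_pow, sq_abs, sq_abs]
    ring
  have hcross : 0 ≤ 2 * (a * b) * inner ℝ x y := by positivity
  have hcoef : 1 / 4 ≤ a ^ 2 + b ^ 2 := by
    obtain rfl : b = 1 - a := by linarith
    nlinarith [sq_nonneg (2 * a - 1)]
  refine le_of_sq_le_sq ?_ (norm_nonneg _)
  nlinarith [mul_le_mul_of_nonneg_right hcoef (sq_nonneg r)]

theorem exists_norm_eq_inner_eq_zero_inner_nonneg (hE : 1 < Module.finrank ℝ E) (x y : E)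
    {r : ℝ} (hr : 0 ≤ r) : ∃ z : E, ‖z‖ = r ∧ inner ℝ x z = 0 ∧ 0 ≤ inner ℝ z y := by
  have hne : (ℝ ∙ x)ᗮ ≠ ⊥ := fun h => by
    have htop : (ℝ ∙ x) = ⊤ := (Submodule.orthogonal_eq_bot_iff).1 h
    exact hE.not_ge (finrank_le_one x fun w =>
      Submodule.mem_span_singleton.1 (htop ▸ Submodule.mem_top))
  obtain ⟨v, hv, hv0⟩ := Submodule.exists_mem_ne_zero_of_ne_bot hne
  have hxv : inner ℝ x v = 0 := Submodule.mem_orthogonal_singleton_iff_inner_right.1 hv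
  have hnorm : ‖(r / ‖v‖) • v‖ = r := by
    rw [norm_smul, Real.norm_of_nonneg (by positivity),
      div_mul_cancel₀ _ (norm_ne_zero_iff.2 hv0)]
  rcases le_total 0 (inner ℝ ((r / ‖v‖) • v) y) with h | h
  · exact ⟨(r / ‖v‖) • v, hnorm, by simp [inner_smul_right, hxv], h⟩
  · exact ⟨-((r / ‖v‖) • v), by rw [norm_neg, hnorm], by simp [inner_smul_right, hxv],
      by rw [inner_neg_left]; linarith⟩

variable [CompleteSpace E] {r₀ C r : ℝ} {u : E → ℝ}

theorem abs_sub_le_of_gradient_decay_of_inner_nonneg (hr₀ : 0 < r₀) (hC : 0 ≤ C)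
    (hdiff : ∀ x : E, r₀ ≤ ‖x‖ → DifferentiableAt ℝ u x)
    (hgrad : ∀ x : E, r₀ ≤ ‖x‖ → ‖gradient u x‖ ≤ C / ‖x‖ ^ 2)
    (hr : 2 * r₀ ≤ r) {x y : E} (hx : ‖x‖ = r) (hy : ‖y‖ = r) (hxy : 0 ≤ inner ℝ x y) :
    |u y - u x| ≤ 8 * C / r := by
  have hrpos : 0 < r := by linarith
  have hfar : ∀ z ∈ segment ℝ x y, r / 2 ≤ ‖z‖ := fun z hz =>
    half_le_norm_of_mem_segment hx hy hxy hz
  have hmv := (convex_segment (𝕜 := ℝ) x y).norm_image_sub_le_of_norm_fderiv_le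
    (𝕜 := ℝ) (f := u) (C := C / (r / 2) ^ 2)
    (fun z hz => hdiff z (by linarith [hfar z hz]))
    (fun z hz => by
      have hz' := hfar z hz
      rw [← norm_gradient_eq_norm_fderiv]
      refine (hgrad z (by linarith)).trans ?_
      gcongr)
    (left_mem_segment ℝ x y) (right_mem_segment ℝ x y)
  have hdist : ‖y - x‖ ≤ 2 * r := by linarith [norm_sub_le y x]
  calc |u y - u x| ≤ C / (r / 2) ^ 2 * ‖y - x‖ := hmv
    _ ≤ C / (r / 2) ^ 2 * (2 * r) := by gcongr
    _ = 8 * C / r := by field_simp; norm_num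

/-- In dimension at least two, a function whose gradient is `O(‖x‖⁻²)` oscillates by `O(r⁻¹)` on
the sphere of radius `r`. -/
theorem abs_sub_le_of_gradient_decay (hE : 1 < Module.finrank ℝ E) (hr₀ : 0 < r₀) (hC : 0 ≤ C)
    (hdiff : ∀ x : E, r₀ ≤ ‖x‖ → DifferentiableAt ℝ u x)
    (hgrad : ∀ x : E, r₀ ≤ ‖x‖ → ‖gradient u x‖ ≤ C / ‖x‖ ^ 2)
    (hr : 2 * r₀ ≤ r) {x y : E} (hx : ‖x‖ = r) (hy : ‖y‖ = r) :
    |u y - u x| ≤ 16 * C / r := by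
  obtain ⟨z, hz, hxz, hzy⟩ :=
    exists_norm_eq_inner_eq_zero_inner_nonneg hE x y (r := r) (by linarith)
  have h₁ := abs_sub_le_of_gradient_decay_of_inner_nonneg hr₀ hC hdiff hgrad hr hx hz hxz.ge
  have h₂ := abs_sub_le_of_gradient_decay_of_inner_nonneg hr₀ hC hdiff hgrad hr hz hy hzy
  calc |u y - u x| ≤ |u y - u z| + |u z - u x| := abs_sub_le _ _ _
    _ ≤ 8 * C / r + 8 * C / r := add_le_add h₂ h₁
    _ = 16 * C / r := by ring

end GradientDecay

/-- If `u : ℝ³ → ℝ` is differentiable on `{‖x‖ ≥ r₀}` with `‖∇u(x)‖ ≤ C/‖x‖²` there,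
and `u(r·e) → 0` as `r → ∞` along a fixed unit vector `e`, then `u(x) → 0` as
`‖x‖ → ∞`; in particular `sup_{‖x‖ = r} |u(x)| → 0` as `r → ∞`. -/
theorem tendsto_zero_of_grad_decay_of_ray
    (r₀ C : ℝ) (hr₀ : 0 < r₀) (hC : 0 ≤ C) (u : EuclideanSpace ℝ (Fin 3) → ℝ)
    (hdiff : ∀ x : EuclideanSpace ℝ (Fin 3), r₀ ≤ ‖x‖ → DifferentiableAt ℝ u x)
    (hgrad : ∀ x : EuclideanSpace ℝ (Fin 3), r₀ ≤ ‖x‖ →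
      ‖gradient u x‖ ≤ C / ‖x‖ ^ 2)
    (e : EuclideanSpace ℝ (Fin 3)) (he : ‖e‖ = 1)
    (hray : Tendsto (fun r : ℝ => u (r • e)) atTop (𝓝 0)) :
    Tendsto u (Filter.comap norm atTop) (𝓝 0) ∧
    Tendsto (fun r : ℝ =>
        sSup ((fun x => |u x|) '' Metric.sphere (0 : EuclideanSpace ℝ (Fin 3)) r))
      atTop (𝓝 0) := by
  have hbound : ∀ x, 2 * r₀ ≤ ‖x‖ → |u x| ≤ |u (‖x‖ • e)| + 16 * C / ‖x‖ := fun x hx => by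
    have hosc := abs_sub_le_of_gradient_decay (by simp) hr₀ hC hdiff hgrad hx
      (x := ‖x‖ • e) (y := x) (by simp [norm_smul, he]) rfl
    linarith [abs_sub_abs_le_abs_sub (u x) (u (‖x‖ • e))]
  have hlim : Tendsto (fun r : ℝ => |u (r • e)| + 16 * C / r) atTop (𝓝 0) := by
    simpa using hray.abs.add (tendsto_const_nhds.div_atTop tendsto_id)
  refine ⟨?_, ?_⟩
  · refine squeeze_zero_norm' ?_ (hlim.comp tendsto_comap)
    filter_upwards [tendsto_comap.eventually (eventually_ge_atTop (2 * r₀))] with x hx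
    exact hbound x hx
  · refine squeeze_zero' (Eventually.of_forall fun r => Real.sSup_nonneg ?_) ?_ hlim
    · rintro _ ⟨x, -, rfl⟩
      exact abs_nonneg _
    · filter_upwards [eventually_ge_atTop (2 * r₀)] with r hr
      have hrpos : 0 < r := by linarith
      refine Real.sSup_le ?_ (by positivity)
      rintro _ ⟨x, hx, rfl⟩
      obtain rfl : ‖x‖ = r := mem_sphere_zero_iff_norm.1 hx
      exact hbound x hr
end

section
/- Let B̄ = {x ∈ ℝ³ : ‖x‖ ≤ 1} be the closed unit ball and let c > 0. Let ρ : ℝ³ → ℝ be continuous on B̄ with ρ(x) > 0 for all x ∈ B̄, twice continuously differentiable on the open ball {‖x‖ < 1} with Δ(log ρ)(x) = ‖∇ρ(x)‖²/ρ(x)² for all ‖x‖ < 1, and satisfy ρ(x) = c for all ‖x‖ = 1. Then ρ(x) = c for all x ∈ B̄. -/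
open Real Filter
open scoped RealInnerProductSpace Topology

/-- The Laplacian of `f : ℝⁿ → ℝ` at `x`: the sum of the unmixed second partial
derivatives (the trace of the second derivative). -/
noncomputable def laplacian {n : ℕ} (f : EuclideanSpace ℝ (Fin n) → ℝ)
    (x : EuclideanSpace ℝ (Fin n)) : ℝ :=
  ∑ i, fderiv ℝ (fun y => fderiv ℝ f y (EuclideanSpace.single i 1)) x
    (EuclideanSpace.single i 1)

/-- Second derivative test: at a local maximum the second derivative is nonpositive. -/
theorem IsLocalMax.deriv_deriv_nonpos {g : ℝ → ℝ} {a : ℝ} (h : IsLocalMax g a)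
    (hg : ContinuousAt g a) : deriv (deriv g) a ≤ 0 := by
  by_contra! hpos
  have hmin : IsLocalMin g a := isLocalMin_of_deriv_deriv_pos hpos h.deriv_eq_zero hg
  have hconst : g =ᶠ[𝓝 a] fun _ => g a := by
    filter_upwards [h, hmin] with t h₁ h₂ using le_antisymm h₁ h₂
  have hzero : deriv (deriv g) a = 0 := by
    rw [hconst.deriv.deriv_eq]
    simp
  exact hpos.ne' hzero

theorem ContDiffAt.differentiableAt_fderiv_apply {E : Type*} [NormedAddCommGroup E]
    [NormedSpace ℝ E] {f : E → ℝ} {x : E} (hf : ContDiffAt ℝ 2 f x) (v : E) :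
    DifferentiableAt ℝ (fun y => fderiv ℝ f y v) x :=
  ((hf.fderiv_right (m := 1) (by norm_num)).differentiableAt (by norm_num)).clm_apply
    (differentiableAt_const v)

theorem ContDiffAt.eventually_differentiableAt {E : Type*} [NormedAddCommGroup E]
    [NormedSpace ℝ E] {f : E → ℝ} {x : E} (hf : ContDiffAt ℝ 2 f x) :
    ∀ᶠ y in 𝓝 x, DifferentiableAt ℝ f y :=
  (hf.eventually (by simp)).mono fun _ hy => hy.differentiableAt (by norm_num)

theorem IsLocalMax.fderiv_fderiv_apply_nonpos {E : Type*} [NormedAddCommGroup E]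
    [NormedSpace ℝ E] {f : E → ℝ} {x : E} (h : IsLocalMax f x) (hf : ContDiffAt ℝ 2 f x)
    (v : E) : fderiv ℝ (fun y => fderiv ℝ f y v) x v ≤ 0 := by
  have hline : ∀ t : ℝ, HasDerivAt (fun s : ℝ => x + s • v) v t := fun t => by
    simpa using ((hasDerivAt_id t).smul_const v).const_add x
  have hx : x + (0 : ℝ) • v = x := by simp
  have htend : Tendsto (fun s : ℝ => x + s • v) (𝓝 0) (𝓝 x) := by
    simpa using (hline 0).continuousAt.tendsto
  have hfirst : deriv (fun t : ℝ => f (x + t • v)) =ᶠ[𝓝 0]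
      fun t => fderiv ℝ f (x + t • v) v := by
    filter_upwards [htend.eventually hf.eventually_differentiableAt] with t ht
    exact (ht.hasFDerivAt.comp_hasDerivAt t (hline t)).deriv
  have hsecond : deriv (deriv fun t : ℝ => f (x + t • v)) 0 =
      fderiv ℝ (fun y => fderiv ℝ f y v) x v := by
    rw [hfirst.deriv_eq]
    have hd := (hf.differentiableAt_fderiv_apply v).hasFDerivAt
    rw [← hx] at hd
    have := (hd.comp_hasDerivAt (0 : ℝ) (hline 0)).deriv
    rw [hx] at this
    exact this
  rw [← hsecond]
  refine IsLocalMax.deriv_deriv_nonpos ?_ ?_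
  · have := htend.eventually h
    simpa [IsLocalMax, IsMaxFilter] using this
  · have hc := hf.continuousAt
    rw [← hx] at hc
    exact ContinuousAt.comp (f := fun s : ℝ => x + s • v) hc (hline 0).continuousAt

theorem IsLocalMax.laplacian_nonpos {n : ℕ} {f : EuclideanSpace ℝ (Fin n) → ℝ}
    {x : EuclideanSpace ℝ (Fin n)} (h : IsLocalMax f x) (hf : ContDiffAt ℝ 2 f x) :
    laplacian f x ≤ 0 :=
  Finset.sum_nonpos fun _ _ => h.fderiv_fderiv_apply_nonpos hf _

theorem hasFDerivAt_const_mul_norm_sq {E : Type*} [NormedAddCommGroup E]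
    [InnerProductSpace ℝ E] (ε : ℝ) (x : E) :
    HasFDerivAt (fun y : E => ε * ‖y‖ ^ 2) ((2 * ε) • innerSL ℝ x) x := by
  refine ((hasStrictFDerivAt_norm_sq x).hasFDerivAt.const_mul ε).congr_fderiv ?_
  ext v
  simp
  ring

theorem laplacian_add_const_mul_norm_sq {n : ℕ} {f : EuclideanSpace ℝ (Fin n) → ℝ}
    {x : EuclideanSpace ℝ (Fin n)} (hf : ContDiffAt ℝ 2 f x) (ε : ℝ) :
    laplacian (fun y => f y + ε * ‖y‖ ^ 2) x = laplacian f x + 2 * n * ε := by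
  have hterm : ∀ v : EuclideanSpace ℝ (Fin n),
      fderiv ℝ (fun y => fderiv ℝ (fun z => f z + ε * ‖z‖ ^ 2) y v) x v =
        fderiv ℝ (fun y => fderiv ℝ f y v) x v + 2 * ε * ‖v‖ ^ 2 := by
    intro v
    have hfirst : (fun y => fderiv ℝ (fun z => f z + ε * ‖z‖ ^ 2) y v) =ᶠ[𝓝 x]
        fun y => fderiv ℝ f y v + ((2 * ε) • innerSL ℝ v) y := by
      filter_upwards [hf.eventually_differentiableAt] with y hy
      rw [(hy.hasFDerivAt.fun_add (hasFDerivAt_const_mul_norm_sq ε y)).fderiv]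
      simp [real_inner_comm]
    rw [hfirst.fderiv_eq, ((hf.differentiableAt_fderiv_apply v).hasFDerivAt.fun_add
      ((2 * ε) • innerSL ℝ v).hasFDerivAt).fderiv]
    simp
  simp only [laplacian, hterm, Finset.sum_add_distrib]
  simp
  ring

theorem laplacian_neg {n : ℕ} (f : EuclideanSpace ℝ (Fin n) → ℝ)
    (x : EuclideanSpace ℝ (Fin n)) : laplacian (fun y => -f y) x = -laplacian f x := by
  simp [laplacian, fderiv_fun_neg]

/-- Weak maximum principle on the unit ball for the differential inequality
`Δf + ‖∇f‖² ≥ 0`. -/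
theorem le_of_neg_sq_norm_fderiv_le_laplacian {n : ℕ} [NeZero n]
    {f : EuclideanSpace ℝ (Fin n) → ℝ} {b : ℝ}
    (hcont : ContinuousOn f (Metric.closedBall 0 1))
    (hreg : ContDiffOn ℝ 2 f (Metric.ball 0 1))
    (hlap : ∀ x : EuclideanSpace ℝ (Fin n), ‖x‖ < 1 → -‖fderiv ℝ f x‖ ^ 2 ≤ laplacian f x)
    (hbdry : ∀ x : EuclideanSpace ℝ (Fin n), ‖x‖ = 1 → f x ≤ b)
    {x : EuclideanSpace ℝ (Fin n)} (hx : x ∈ Metric.closedBall 0 1) : f x ≤ b := by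
  have hn : (1 : ℝ) ≤ n := by exact_mod_cast NeZero.one_le
  have key : ∀ ε ∈ Set.Ioo (0 : ℝ) (1 / 2), f x ≤ b + ε := by
    rintro ε ⟨hε, hε'⟩
    obtain ⟨m, hm, hmax⟩ := (isCompact_closedBall (0 : EuclideanSpace ℝ (Fin n)) 1).exists_isMaxOn
      ⟨x, hx⟩ (hcont.add (f := f) (g := fun y => ε * ‖y‖ ^ 2) (by fun_prop))
    have hmx : f x + ε * ‖x‖ ^ 2 ≤ f m + ε * ‖m‖ ^ 2 := hmax hx
    have hsq : 0 ≤ ε * ‖x‖ ^ 2 := by positivity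
    rcases (mem_closedBall_zero_iff.1 hm).lt_or_eq with hlt | heq
    · exfalso
      have hnhds : Metric.ball (0 : EuclideanSpace ℝ (Fin n)) 1 ∈ 𝓝 m :=
        Metric.isOpen_ball.mem_nhds (mem_ball_zero_iff.2 hlt)
      have hfm : ContDiffAt ℝ 2 f m := hreg.contDiffAt hnhds
      have hloc : IsLocalMax (fun y => f y + ε * ‖y‖ ^ 2) m :=
        hmax.isLocalMax (mem_of_superset hnhds Metric.ball_subset_closedBall)
      have hnonpos := hloc.laplacian_nonpos
        (hfm.add (contDiffAt_const.mul (contDiff_norm_sq ℝ).contDiffAt))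
      rw [laplacian_add_const_mul_norm_sq hfm] at hnonpos
      have hcrit : fderiv ℝ f m + (2 * ε) • innerSL ℝ m = 0 := by
        rw [← ((hfm.differentiableAt (by norm_num)).hasFDerivAt.fun_add
          (hasFDerivAt_const_mul_norm_sq ε m)).fderiv]
        exact hloc.fderiv_eq_zero
      have hnorm : ‖fderiv ℝ f m‖ = 2 * ε * ‖m‖ := by
        rw [eq_neg_of_add_eq_zero_left hcrit, norm_neg, norm_smul, innerSL_apply_norm,
          Real.norm_of_nonneg (by positivity)]
      have hl := hlap m hlt
      rw [hnorm] at hl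
      have hm2 : ‖m‖ ^ 2 ≤ 1 := pow_le_one₀ (norm_nonneg m) hlt.le
      have h₁ : (2 * ε * ‖m‖) ^ 2 ≤ 4 * ε ^ 2 := by
        nlinarith [mul_le_mul_of_nonneg_left hm2 (sq_nonneg ε)]
      have h₂ : ε ≤ n * ε := le_mul_of_one_le_left hε.le hn
      nlinarith
    · have := hbdry m heq
      rw [heq] at hmx
      linarith
  have hev : ∀ᶠ ε in 𝓝[>] (0 : ℝ), f x ≤ b + ε :=
    mem_of_superset (Ioo_mem_nhdsGT (by norm_num)) key
  have htend : Tendsto (fun ε : ℝ => b + ε) (𝓝[>] 0) (𝓝 b) := by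
    have hc : Continuous fun ε : ℝ => b + ε := by fun_prop
    exact (hc.tendsto' 0 b (add_zero b)).mono_left nhdsWithin_le_nhds
  exact ge_of_tendsto htend hev

/-- A positive density `ρ`, continuous on the closed unit ball, `C²` in the open
ball with `Δ(log ρ) = ‖∇ρ‖²/ρ²` there, and equal to a constant `c > 0` on the unit
sphere, is identically `c` on the closed ball. -/
theorem density_constant_of_log_harmonic_identity
    (c : ℝ) (hc : 0 < c) (ρ : EuclideanSpace ℝ (Fin 3) → ℝ)
    (hcont : ContinuousOn ρ (Metric.closedBall 0 1))
    (hpos : ∀ x ∈ Metric.closedBall (0 : EuclideanSpace ℝ (Fin 3)) 1, 0 < ρ x)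
    (hreg : ContDiffOn ℝ 2 ρ (Metric.ball 0 1))
    (heq : ∀ x : EuclideanSpace ℝ (Fin 3), ‖x‖ < 1 →
      laplacian (fun y => Real.log (ρ y)) x = ‖gradient ρ x‖ ^ 2 / ρ x ^ 2)
    (hbdry : ∀ x : EuclideanSpace ℝ (Fin 3), ‖x‖ = 1 → ρ x = c) :
    ∀ x ∈ Metric.closedBall (0 : EuclideanSpace ℝ (Fin 3)) 1, ρ x = c := by
  have hball : ∀ x : EuclideanSpace ℝ (Fin 3), ‖x‖ < 1 → x ∈ Metric.closedBall 0 1 :=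
    fun x hx => mem_closedBall_zero_iff.2 hx.le
  have hLcont : ContinuousOn (fun y => Real.log (ρ y)) (Metric.closedBall 0 1) :=
    hcont.log fun x hx => (hpos x hx).ne'
  have hLreg : ContDiffOn ℝ 2 (fun y => Real.log (ρ y)) (Metric.ball 0 1) :=
    hreg.log fun x hx => (hpos x (Metric.ball_subset_closedBall hx)).ne'
  have hLlap : ∀ x : EuclideanSpace ℝ (Fin 3), ‖x‖ < 1 →
      laplacian (fun y => Real.log (ρ y)) x = ‖fderiv ℝ (fun y => Real.log (ρ y)) x‖ ^ 2 := by
    intro x hx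
    have hρ := hpos x (hball x hx)
    have hd : DifferentiableAt ℝ ρ x :=
      (hreg.contDiffAt (Metric.isOpen_ball.mem_nhds (mem_ball_zero_iff.2 hx))).differentiableAt
        (by norm_num)
    rw [heq x hx, (hd.hasFDerivAt.log hρ.ne').fderiv, norm_smul, gradient,
      LinearIsometryEquiv.norm_map, norm_inv, Real.norm_of_nonneg hρ.le]
    field_simp
  intro x hx
  have hle : Real.log (ρ x) ≤ Real.log c :=
    le_of_neg_sq_norm_fderiv_le_laplacian hLcont hLreg
      (fun y hy => by rw [hLlap y hy]; linarith [sq_nonneg ‖fderiv ℝ (fun y => Real.log (ρ y)) y‖])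
      (fun y hy => by rw [hbdry y hy]) hx
  have hge : -Real.log (ρ x) ≤ -Real.log c :=
    le_of_neg_sq_norm_fderiv_le_laplacian (f := fun y => -Real.log (ρ y)) hLcont.neg hLreg.neg
      (fun y hy => by rw [laplacian_neg, hLlap y hy, fderiv_fun_neg, norm_neg])
      (fun y hy => by rw [hbdry y hy]) hx
  exact Real.log_injOn_pos (hpos x hx) hc (le_antisymm hle (neg_le_neg_iff.1 hge))
end

section
/- Let ρ_l > 0, R_* > 0, σ > 0 be real numbers and let ℓ ≥ 2 be a natural number, and set ω = √(σ(ℓ+2)(ℓ+1)(ℓ−1)/(ρ_l R_*³)). Suppose a, b : ℝ → ℝ are differentiable and satisfy the first-order system a′(t) = −(ℓ+1)·b(t) and b′(t) = (σ/(ρ_l R_*³))·(ℓ+2)(ℓ−1)·a(t) for all t ∈ ℝ. Then a is twice differentiable and satisfies ρ_l R_* a″(t) + (σ/R_*²)(ℓ+2)(ℓ+1)(ℓ−1)·a(t) = 0 for all t, and both a and b are periodic with period 2π/ω, i.e. a(t + 2π/ω) = a(t) and b(t + 2π/ω) = b(t) for all t ∈ ℝ. -/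
open Real

/-- Explicit solution of the planar system `a′ = −p b`, `b′ = q a` with `ω² = p q`. -/
lemma linear_oscillator_solution {a b : ℝ → ℝ} {p q ω : ℝ} (hω : ω ^ 2 = p * q)
    (ha : ∀ t, HasDerivAt a (-p * b t) t) (hb : ∀ t, HasDerivAt b (q * a t) t) (t : ℝ) :
    ω * a t = ω * a 0 * cos (ω * t) - p * b 0 * sin (ω * t) ∧
      p * b t = ω * a 0 * sin (ω * t) + p * b 0 * cos (ω * t) := by
  have hlin (s : ℝ) : HasDerivAt (fun s => ω * s) ω s := by
    simpa using (hasDerivAt_id s).const_mul ω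
  have hU (s : ℝ) :
      HasDerivAt (fun s => ω * a s * cos (ω * s) + p * b s * sin (ω * s)) 0 s := by
    refine ((((ha s).const_mul ω).fun_mul (hlin s).cos).fun_add
      (((hb s).const_mul p).fun_mul (hlin s).sin)).congr_deriv ?_
    linear_combination -(a s * sin (ω * s)) * hω
  have hV (s : ℝ) :
      HasDerivAt (fun s => ω * a s * sin (ω * s) - p * b s * cos (ω * s)) 0 s := by
    refine ((((ha s).const_mul ω).fun_mul (hlin s).sin).fun_sub
      (((hb s).const_mul p).fun_mul (hlin s).cos)).congr_deriv ?_
    linear_combination (a s * cos (ω * s)) * hω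
  have hU0 := is_const_of_deriv_eq_zero (fun s => (hU s).differentiableAt)
    (fun s => (hU s).deriv) t 0
  have hV0 := is_const_of_deriv_eq_zero (fun s => (hV s).differentiableAt)
    (fun s => (hV s).deriv) t 0
  simp only [mul_zero, cos_zero, sin_zero, mul_one, add_zero, zero_sub] at hU0 hV0
  have hcs := sin_sq_add_cos_sq (ω * t)
  constructor
  · linear_combination cos (ω * t) * hU0 + sin (ω * t) * hV0 - ω * a t * hcs
  · linear_combination sin (ω * t) * hU0 - cos (ω * t) * hV0 - p * b t * hcs

/-- Solutions of `a′ = −p b`, `b′ = q a` with `p q = ω² > 0` have period `2π/ω`. -/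
lemma linear_oscillator_periodic {a b : ℝ → ℝ} {p q ω : ℝ} (hω : ω ^ 2 = p * q)
    (hω0 : ω ≠ 0) (hp : p ≠ 0)
    (ha : ∀ t, HasDerivAt a (-p * b t) t) (hb : ∀ t, HasDerivAt b (q * a t) t) :
    Function.Periodic a (2 * π / ω) ∧ Function.Periodic b (2 * π / ω) := by
  have hsol := linear_oscillator_solution hω ha hb
  have harg (t : ℝ) : ω * (t + 2 * π / ω) = ω * t + 2 * π := by field_simp
  refine ⟨fun t => mul_left_cancel₀ hω0 ?_, fun t => mul_left_cancel₀ hp ?_⟩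
  · rw [(hsol _).1, (hsol t).1, harg, cos_add_two_pi, sin_add_two_pi]
  · rw [(hsol _).2, (hsol t).2, harg, cos_add_two_pi, sin_add_two_pi]

/-- The coupled first-order system `a′ = −(ℓ+1)b`,
`b′ = (σ/(ρ_l R_*³))(ℓ+2)(ℓ−1)a` (ℓ ≥ 2) implies that `a` is twice
differentiable, satisfies `ρ_l R_* a″ + (σ/R_*²)(ℓ+2)(ℓ+1)(ℓ−1)a = 0`, and both
`a` and `b` are periodic with period `2π/ω`,
`ω = √(σ(ℓ+2)(ℓ+1)(ℓ−1)/(ρ_l R_*³))`. -/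
theorem shape_mode_system_oscillation
    (ρl Rs σ : ℝ) (hρ : 0 < ρl) (hR : 0 < Rs) (hσ : 0 < σ)
    (ℓ : ℕ) (hℓ : 2 ≤ ℓ) (ω : ℝ)
    (hω : ω = Real.sqrt (σ * ((ℓ : ℝ) + 2) * ((ℓ : ℝ) + 1) * ((ℓ : ℝ) - 1)
      / (ρl * Rs ^ 3)))
    (a b : ℝ → ℝ) (ha : Differentiable ℝ a) (hb : Differentiable ℝ b)
    (hsys1 : ∀ t : ℝ, deriv a t = -((ℓ : ℝ) + 1) * b t)
    (hsys2 : ∀ t : ℝ, deriv b t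
      = (σ / (ρl * Rs ^ 3)) * ((ℓ : ℝ) + 2) * ((ℓ : ℝ) - 1) * a t) :
    Differentiable ℝ (deriv a) ∧
    (∀ t : ℝ, ρl * Rs * deriv (deriv a) t
      + (σ / Rs ^ 2) * ((ℓ : ℝ) + 2) * ((ℓ : ℝ) + 1) * ((ℓ : ℝ) - 1) * a t = 0) ∧
    (∀ t : ℝ, a (t + 2 * Real.pi / ω) = a t) ∧
    (∀ t : ℝ, b (t + 2 * Real.pi / ω) = b t) := by
  have hℓ' : (2 : ℝ) ≤ ℓ := by exact_mod_cast hℓ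
  have hℓ1 : 0 < (ℓ : ℝ) - 1 := by linarith
  have hpos : 0 < σ * ((ℓ : ℝ) + 2) * ((ℓ : ℝ) + 1) * ((ℓ : ℝ) - 1) / (ρl * Rs ^ 3) := by
    positivity
  have hω0 : ω ≠ 0 := hω ▸ (Real.sqrt_pos.2 hpos).ne'
  have hωsq : ω ^ 2 = ((ℓ : ℝ) + 1) *
      ((σ / (ρl * Rs ^ 3)) * ((ℓ : ℝ) + 2) * ((ℓ : ℝ) - 1)) := by
    rw [hω, Real.sq_sqrt hpos.le]
    ring
  have hderiv : deriv a = fun t => -((ℓ : ℝ) + 1) * b t := funext hsys1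
  obtain ⟨hpa, hpb⟩ := linear_oscillator_periodic hωsq hω0 (by positivity)
    (fun t => hsys1 t ▸ (ha t).hasDerivAt) (fun t => hsys2 t ▸ (hb t).hasDerivAt)
  refine ⟨hderiv ▸ hb.const_mul _, fun t => ?_, hpa, hpb⟩
  rw [hderiv, deriv_const_mul _ (hb t), hsys2]
  field_simp
  ring
end

section
/- Let n ≥ 1 and let Ω ⊆ ℝⁿ be a nonempty bounded open set with closure cl(Ω). Let u : [0,∞) × cl(Ω) → ℝ satisfy: (i) for each t ≥ 0 the function x ↦ u(t,x) is continuous on cl(Ω); (ii) the family {u(t,·) : t ≥ 0} is uniformly equicontinuous on cl(Ω), i.e. for every ε > 0 there is δ > 0 such that |u(t,x) − u(t,y)| < ε whenever t ≥ 0, x, y ∈ cl(Ω) and ‖x − y‖ < δ; (iii) the function M(t) := max_{x ∈ cl(Ω)} |u(t,x)| is nonincreasing in t; (iv) ∫_Ω |u(t,x)|² dx → 0 as t → ∞ (integral with respect to Lebesgue measure). Then M(t) → 0 as t → ∞. -/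
open Real Filter MeasureTheory
open scoped Topology

/-- If `K` is a compact subset of the closure of an open set `s` of finite measure, then the
measure of `s ∩ ball x r` is bounded below by a positive constant, uniformly in `x ∈ K`. -/
theorem IsCompact.exists_pos_le_measureReal_inter_ball
    {X : Type*} [PseudoMetricSpace X] [MeasurableSpace X] {μ : Measure X} [μ.IsOpenPosMeasure]
    {s K : Set X} (hs : IsOpen s) (hμs : μ s ≠ ⊤) (hK : IsCompact K) (hKs : K ⊆ closure s)
    {r : ℝ} (hr : 0 < r) :
    ∃ c : ℝ, 0 < c ∧ ∀ x ∈ K, c ≤ μ.real (s ∩ Metric.ball x r) := by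
  have hfin : ∀ x ρ, μ (s ∩ Metric.ball x ρ) ≠ ⊤ := fun x ρ =>
    measure_ne_top_of_subset Set.inter_subset_left hμs
  refine hK.induction_on
    (p := fun A => ∃ c : ℝ, 0 < c ∧ ∀ x ∈ A, c ≤ μ.real (s ∩ Metric.ball x r)) ?_ ?_ ?_ ?_
  · exact ⟨1, one_pos, by simp⟩
  · rintro A B hAB ⟨c, hc, h⟩
    exact ⟨c, hc, fun x hx => h x (hAB hx)⟩
  · rintro A B ⟨c, hc, h⟩ ⟨d, hd, h'⟩
    refine ⟨min c d, lt_min hc hd, ?_⟩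
    rintro x (hx | hx)
    · exact (min_le_left _ _).trans (h x hx)
    · exact (min_le_right _ _).trans (h' x hx)
  · intro x hx
    refine ⟨Metric.ball x (r / 2),
      mem_nhdsWithin_of_mem_nhds (Metric.ball_mem_nhds x (half_pos hr)),
      μ.real (s ∩ Metric.ball x (r / 2)), ?_, fun y hy => ?_⟩
    · refine ENNReal.toReal_pos ?_ (hfin _ _)
      refine ((hs.inter Metric.isOpen_ball).measure_pos μ ?_).ne'
      rw [Set.inter_comm]
      exact mem_closure_iff.1 (hKs hx) _ Metric.isOpen_ball (Metric.mem_ball_self (half_pos hr))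
    · refine measureReal_mono (Set.inter_subset_inter_right _ ?_) (hfin _ _)
      refine Metric.ball_subset_ball' ?_
      have := Metric.mem_ball'.1 hy
      linarith

/-- The compactness step in the proof of Lemma C.1: if `u(t,·)` is continuous on
the closure of a nonempty bounded open set `Ω`, the family `{u(t,·)}` is uniformly
equicontinuous there, the sup norm `M(t) = max_{cl(Ω)} |u(t,·)|` is nonincreasing,
and the `L²` norm of `u(t,·)` on `Ω` tends to zero, then `M(t) → 0` as `t → ∞`. -/
theorem sup_decay_of_L2_decay
    {n : ℕ} (hn : 1 ≤ n) (Ω : Set (EuclideanSpace ℝ (Fin n)))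
    (hΩo : IsOpen Ω) (hΩne : Ω.Nonempty) (hΩb : Bornology.IsBounded Ω)
    (u : ℝ → EuclideanSpace ℝ (Fin n) → ℝ)
    (hcont : ∀ t : ℝ, 0 ≤ t → ContinuousOn (u t) (closure Ω))
    (hequi : ∀ ε : ℝ, 0 < ε → ∃ δ : ℝ, 0 < δ ∧ ∀ t : ℝ, 0 ≤ t →
      ∀ x ∈ closure Ω, ∀ y ∈ closure Ω, ‖x - y‖ < δ → |u t x - u t y| < ε)
    (M : ℝ → ℝ) (hM : ∀ t : ℝ, M t = sSup ((fun x => |u t x|) '' closure Ω))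
    (hmono : ∀ s t : ℝ, 0 ≤ s → s ≤ t → M t ≤ M s)
    (hL2 : Tendsto (fun t : ℝ => ∫ x in Ω, (u t x) ^ 2) atTop (𝓝 0)) :
    Tendsto M atTop (𝓝 0) := by
  have hK : IsCompact (closure Ω) := hΩb.isCompact_closure
  have hvol : volume Ω ≠ ⊤ := hΩb.measure_lt_top.ne
  rw [Metric.tendsto_nhds]
  intro ε hε
  obtain ⟨δ, hδ, hu⟩ := hequi (ε / 4) (by positivity)
  obtain ⟨c, hc, hcb⟩ := hK.exists_pos_le_measureReal_inter_ball hΩo hvol subset_rfl hδ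
  have hpos : 0 < (ε / 4) ^ 2 * c := by positivity
  filter_upwards [eventually_ge_atTop 0, hL2.eventually_lt_const hpos] with t ht hlt
  have hbound : ∀ x ∈ closure Ω, |u t x| ≤ ε / 2 := by
    intro x hx
    by_contra! hux
    have hint : IntegrableOn (fun y => (u t y) ^ 2) Ω :=
      (((hcont t ht).pow 2).integrableOn_compact hK).mono_set subset_closure
    have hlower : ∀ y ∈ Ω ∩ Metric.ball x δ, (ε / 4) ^ 2 ≤ (u t y) ^ 2 := by
      rintro y ⟨hy, hyx⟩
      have hxy := hu t ht x hx y (subset_closure hy) (by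
        rw [← dist_eq_norm]; exact Metric.mem_ball'.1 hyx)
      have := abs_sub_abs_le_abs_sub (u t x) (u t y)
      rw [← sq_abs (u t y)]
      exact pow_le_pow_left₀ (by positivity) (by linarith) 2
    have h₁ : (ε / 4) ^ 2 * volume.real (Ω ∩ Metric.ball x δ)
        ≤ ∫ y in Ω ∩ Metric.ball x δ, (u t y) ^ 2 :=
      setIntegral_ge_of_const_le_real (hΩo.inter Metric.isOpen_ball).measurableSet
        (measure_ne_top_of_subset Set.inter_subset_left hvol) hlower
        (hint.mono_set Set.inter_subset_left)
    have h₂ : ∫ y in Ω ∩ Metric.ball x δ, (u t y) ^ 2 ≤ ∫ y in Ω, (u t y) ^ 2 :=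
      setIntegral_mono_set hint (Eventually.of_forall fun y => sq_nonneg _)
        (Set.inter_subset_left : Ω ∩ Metric.ball x δ ⊆ Ω).eventuallyLE
    have h₃ := mul_le_mul_of_nonneg_left (hcb x hx) (sq_nonneg (ε / 4))
    linarith
  have hnonneg : 0 ≤ M t := by
    rw [hM]
    exact Real.sSup_nonneg (Set.forall_mem_image.2 fun x _ => abs_nonneg _)
  have hle : M t ≤ ε / 2 := by
    rw [hM]
    exact csSup_le (hΩne.closure.image _) (Set.forall_mem_image.2 hbound)
  rw [Real.dist_0_eq_abs, abs_of_nonneg hnonneg]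
  linarith
end

section
/- Let u : ℝ³ → ℝ be twice continuously differentiable on the closed exterior region {x ∈ ℝ³ : ‖x‖ ≥ 1} and harmonic on the open exterior {x : ‖x‖ > 1}, i.e. Δu(x) = 0 for all ‖x‖ > 1. Assume there is a constant C > 0 with ‖∇u(x)‖ ≤ C/‖x‖² and ‖D²u(x)‖ ≤ C/‖x‖³ for all ‖x‖ ≥ 1, where D²u is the second derivative of u. Suppose there is a constant c ∈ ℝ such that ⟪x, ∇u(x)⟫ − u(x) = c for every x with ‖x‖ = 1 (equivalently, the tangential derivatives of ∂_r u − u vanish on the unit sphere). Then u is radial on the exterior region: there exists g : ℝ → ℝ such that u(x) = g(‖x‖) for all ‖x‖ ≥ 1. -/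
open Real Filter
open scoped RealInnerProductSpace Topology

section

open InnerProductSpace Laplacian Module Set

theorem laplacian_eq_of_contDiffAt {n : ℕ} {f : EuclideanSpace ℝ (Fin n) → ℝ}
    {x : EuclideanSpace ℝ (Fin n)} (hf : ContDiffAt ℝ 2 f x) : _root_.laplacian f x = Δ f x := by
  rw [laplacian_eq_iteratedFDeriv_orthonormalBasis f (EuclideanSpace.basisFun (Fin n) ℝ)]
  have hD : DifferentiableAt ℝ (fderiv ℝ f) x :=
    (hf.fderiv_right (m := 1) (by norm_num)).differentiableAt (by simp)
  refine Finset.sum_congr rfl fun i _ => ?_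
  rw [fderiv_clm_apply hD (differentiableAt_const _), iteratedFDeriv_two_apply]
  simp

/-- If at each point of a preconnected set either the Robin condition `g - f = c` or the degenerate
condition `f = -c` holds, then either `f` is constant or each value of `f` is attained at a point
where the Robin condition holds. -/
theorem eq_or_exists_eq_of_preconnected {X : Type*} [TopologicalSpace X] {S : Set X}
    (hS : IsPreconnected S) {f g : X → ℝ} (hf : ContinuousOn f S) (hg : ContinuousOn g S) {c : ℝ}
    (h : ∀ x ∈ S, g x - f x = c ∨ f x = -c) {y : X} (hy : y ∈ S) :
    (∀ x ∈ S, f x = f y) ∨ ∃ z ∈ S, f z = f y ∧ g z - f z = c := by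
  by_contra! hcon
  obtain ⟨⟨x, hx, hxy⟩, hne⟩ := hcon
  have hfy : f y = -c := (h y hy).resolve_left (hne y hy rfl)
  have hiff : ∀ z ∈ S, f z = f y ↔ g z - f z ≠ c := fun z hz =>
    ⟨hne z hz, fun hz' => hfy ▸ (h z hz).resolve_left hz'⟩
  have hconst : ∀ z ∈ S, ∀ᶠ w in 𝓝[S] z, f w = f y ↔ f z = f y := by
    intro z hz
    by_cases hzy : f z = f y
    · have := ((hg.sub hf) z hz).eventually_ne ((hiff z hz).1 hzy)
      filter_upwards [this, self_mem_nhdsWithin] with w hw hwS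
      simpa [hzy] using (hiff w hwS).2 hw
    · filter_upwards [(hf z hz).eventually_ne hzy] with w hw
      simp [hw, hzy]
  classical
  have hcont : ContinuousOn (fun z => decide (f z = f y)) S := fun z hz =>
    continuousWithinAt_const.congr_of_eventuallyEq
      ((hconst z hz).mono fun w hw => decide_eq_decide.2 hw) rfl
  simpa [hxy] using hS.constant hcont hx hy

variable {E : Type*} [NormedAddCommGroup E] [InnerProductSpace ℝ E]

theorem deriv_deriv_nonpos_of_isLocalMax {g : ℝ → ℝ} {a : ℝ} (hc : ContinuousAt g a)
    (h : IsLocalMax g a) : deriv (deriv g) a ≤ 0 := by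
  by_contra! hpos
  have hmin := isLocalMin_of_deriv_deriv_pos hpos h.deriv_eq_zero hc
  have hconst : g =ᶠ[𝓝 a] fun _ => g a := by
    filter_upwards [h, hmin] with t h₁ h₂ using le_antisymm h₁ h₂
  have := hconst.deriv.deriv_eq
  simp at this
  linarith

theorem deriv_deriv_comp_add_smul {f : E → ℝ} {q : E} (hf : ContDiffAt ℝ 2 f q) (v : E) :
    deriv (deriv fun t : ℝ => f (q + t • v)) 0 = iteratedFDeriv ℝ 2 f q ![v, v] := by
  have hline : ∀ t : ℝ, HasDerivAt (fun t : ℝ => q + t • v) v t := fun t => by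
    simpa using ((hasDerivAt_id t).smul_const v).const_add q
  have hq : Tendsto (fun t : ℝ => q + t • v) (𝓝 0) (𝓝 q) := by
    simpa using (hline 0).continuousAt.tendsto
  have hfirst : deriv (fun t : ℝ => f (q + t • v)) =ᶠ[𝓝 0]
      fun t => fderiv ℝ f (q + t • v) v := by
    filter_upwards [hq.eventually (hf.eventually (by simp))] with t ht
    exact ((ht.differentiableAt (by simp)).hasFDerivAt.comp_hasDerivAt t (hline t)).deriv
  rw [hfirst.deriv_eq, iteratedFDeriv_two_apply]
  have hD : DifferentiableAt ℝ (fderiv ℝ f) q :=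
    (hf.fderiv_right (m := 1) (by norm_num)).differentiableAt (by simp)
  have h1 : HasFDerivAt (fderiv ℝ f) (fderiv ℝ (fderiv ℝ f) q) (q + (0 : ℝ) • v) := by
    simpa using hD.hasFDerivAt
  have h2 : HasDerivAt (fun t : ℝ => fderiv ℝ f (q + t • v)) (fderiv ℝ (fderiv ℝ f) q v) 0 :=
    h1.comp_hasDerivAt (0 : ℝ) (hline 0)
  exact ((ContinuousLinearMap.apply ℝ ℝ v).hasFDerivAt.comp_hasDerivAt (0 : ℝ) h2).deriv

theorem uniqueDiffOn_exterior : UniqueDiffOn ℝ {x : E | 1 ≤ ‖x‖} := by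
  intro x hx
  have hx : 1 ≤ ‖x‖ := hx
  have hxpos : 0 < ‖x‖ := by linarith
  have hconv : Convex ℝ {y : E | ‖x‖ ≤ ⟪x, y⟫} :=
    convex_halfSpace_ge (innerSL ℝ x).isLinear ‖x‖
  have hopen : IsOpen {y : E | ‖x‖ < ⟪x, y⟫} :=
    isOpen_lt continuous_const (by fun_prop)
  have hmem : (2 : ℝ) • x ∈ {y : E | ‖x‖ < ⟪x, y⟫} := by
    simp only [mem_ofPred_eq, inner_smul_right, real_inner_self_eq_norm_sq]
    nlinarith
  have hsub : {y : E | ‖x‖ < ⟪x, y⟫} ⊆ {y : E | ‖x‖ ≤ ⟪x, y⟫} := fun y hy =>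
    le_of_lt (show ‖x‖ < ⟪x, y⟫ from hy)
  refine UniqueDiffWithinAt.mono (s := {y : E | ‖x‖ ≤ ⟪x, y⟫})
    (uniqueDiffWithinAt_convex hconv ⟨_, interior_maximal hsub hopen hmem⟩ (subset_closure ?_)) ?_
  · simp only [mem_ofPred_eq, real_inner_self_eq_norm_sq]
    nlinarith
  · intro y hy
    have : ‖x‖ ≤ ‖x‖ * ‖y‖ := le_trans hy (real_inner_le_norm x y)
    exact le_of_mul_le_mul_left (by linarith) hxpos

theorem norm_fderiv_eq_norm_gradient [CompleteSpace E] (f : E → ℝ) (x : E) :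
    ‖fderiv ℝ f x‖ = ‖gradient f x‖ := by
  rw [← toDual_gradient, LinearIsometryEquiv.norm_map]

theorem abs_sub_le_of_inner_nonneg [CompleteSpace E] {u : E → ℝ}
    (hu : ∀ x, 1 < ‖x‖ → DifferentiableAt ℝ u x) {C : ℝ} (hC : 0 ≤ C)
    (hgrad : ∀ x, 1 ≤ ‖x‖ → ‖gradient u x‖ ≤ C / ‖x‖ ^ 2) {x y : E} (hx : 2 ≤ ‖x‖)
    (hxy : ‖x‖ = ‖y‖) (h : 0 ≤ ⟪x, y⟫) : |u x - u y| ≤ 4 * C / ‖x‖ := by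
  have hseg : ∀ p ∈ segment ℝ x y, ‖x‖ ^ 2 / 2 ≤ ‖p‖ ^ 2 := by
    rintro p ⟨a, b, ha, hb, hab, rfl⟩
    rw [norm_add_sq_real, norm_smul, norm_smul, inner_smul_left, inner_smul_right, ← hxy,
      Real.norm_of_nonneg ha, Real.norm_of_nonneg hb]
    have h1 : 0 ≤ a * (b * ⟪x, y⟫) := by positivity
    obtain rfl : b = 1 - a := by linarith
    simp only [conj_trivial]
    nlinarith [mul_nonneg (sq_nonneg (2 * a - 1)) (sq_nonneg ‖x‖)]
  have hseg1 : ∀ p ∈ segment ℝ x y, 1 < ‖p‖ := fun p hp => by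
    nlinarith [hseg p hp, norm_nonneg p]
  have hxpos : 0 < ‖x‖ := by linarith
  have hbound : ∀ p ∈ segment ℝ x y, ‖fderiv ℝ u p‖ ≤ 2 * C / ‖x‖ ^ 2 := fun p hp => by
    rw [norm_fderiv_eq_norm_gradient]
    refine (hgrad p (hseg1 p hp).le).trans ?_
    have hp0 : 0 < ‖p‖ := by linarith [hseg1 p hp]
    rw [div_le_div_iff₀ (by positivity) (by positivity)]
    nlinarith [mul_le_mul_of_nonneg_left (hseg p hp) hC]
  have := (convex_segment x y).norm_image_sub_le_of_norm_fderiv_le (𝕜 := ℝ)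
    (fun p hp => hu p (hseg1 p hp)) hbound (right_mem_segment ℝ x y) (left_mem_segment ℝ x y)
  refine this.trans ?_
  have hd : ‖x - y‖ ≤ 2 * ‖x‖ := by linarith [norm_sub_le x y]
  calc 2 * C / ‖x‖ ^ 2 * ‖x - y‖ ≤ 2 * C / ‖x‖ ^ 2 * (2 * ‖x‖) := by gcongr
    _ = 4 * C / ‖x‖ := by field_simp; ring

theorem hasDerivWithinAt_radial {u : E → ℝ} {L : E →L[ℝ] ℝ} {x : E} (hx : ‖x‖ = 1)
    (h : HasFDerivWithinAt u L {x | 1 ≤ ‖x‖} x) :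
    HasDerivWithinAt (fun t : ℝ => u (t • x)) (L x) (Ici 1) 1 := by
  have hline : HasDerivWithinAt (fun t : ℝ => t • x) x (Ici 1) 1 := by
    simpa using ((hasDerivAt_id (1 : ℝ)).smul_const x).hasDerivWithinAt
  have h' : HasFDerivWithinAt u L {x | 1 ≤ ‖x‖} ((1 : ℝ) • x) := by simpa using h
  refine h'.comp_hasDerivWithinAt (1 : ℝ) hline fun t ht => ?_
  simp only [mem_ofPred_eq, norm_smul, hx, mul_one]
  exact le_trans ht (le_abs_self t)

theorem HasDerivWithinAt.nonpos_of_forall_le {f : ℝ → ℝ} {f' a : ℝ}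
    (h : HasDerivWithinAt f f' (Ici a) a) (hle : ∀ t ∈ Ici a, f t ≤ f a) : f' ≤ 0 := by
  have := IsLocalMaxOn.hasFDerivWithinAt_nonpos (y := (1 : ℝ))
    (eventually_nhdsWithin_of_forall hle) h.hasFDerivWithinAt ?_
  · simpa using this
  · exact mem_posTangentConeAt_of_segment_subset (by
      rw [segment_eq_Icc (by linarith)]; exact Icc_subset_Ici_self)

variable [FiniteDimensional ℝ E]

theorem laplacian_nonpos_of_isLocalMax {f : E → ℝ} {q : E} (hf : ContDiffAt ℝ 2 f q)
    (h : IsLocalMax f q) : Δ f q ≤ 0 := by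
  rw [laplacian_eq_iteratedFDeriv_stdOrthonormalBasis]
  refine Finset.sum_nonpos fun i _ => ?_
  rw [← deriv_deriv_comp_add_smul hf]
  have hcont : Continuous fun t : ℝ => q + t • stdOrthonormalBasis ℝ E i := by fun_prop
  have hq : Tendsto (fun t : ℝ => q + t • stdOrthonormalBasis ℝ E i) (𝓝 0) (𝓝 q) := by
    simpa using hcont.tendsto 0
  refine deriv_deriv_nonpos_of_isLocalMax ?_ ?_
  · refine ContinuousAt.comp (g := f) ?_ hcont.continuousAt
    simpa using hf.continuousAt
  · filter_upwards [hq.eventually h] with t ht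
    simpa using ht

theorem laplacian_norm_sq (q : E) : Δ (fun x : E => ‖x‖ ^ 2) q = 2 * finrank ℝ E := by
  have h : fderiv ℝ (fun x : E => ‖x‖ ^ 2) = fun x => (2 • innerSL ℝ : E →L[ℝ] E →L[ℝ] ℝ) x := by
    ext x v
    simp only [fderiv_norm_sq_apply]
    rfl
  rw [laplacian_eq_iteratedFDeriv_stdOrthonormalBasis]
  have hinner : ∀ v : E, (2 • innerSL ℝ : E →L[ℝ] E →L[ℝ] ℝ) v v = 2 * ‖v‖ ^ 2 := fun v => by
    rw [← real_inner_self_eq_norm_sq, two_nsmul, two_mul]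
    rfl
  simp only [iteratedFDeriv_two_apply, h, ContinuousLinearMap.fderiv]
  calc _ = ∑ _i : Fin (finrank ℝ E), (2 : ℝ) :=
        Finset.sum_congr rfl fun i _ => (hinner (stdOrthonormalBasis ℝ E i)).trans (by simp)
    _ = 2 * finrank ℝ E := by simp [mul_comm]

theorem laplacian_comp_linearIsometryEquiv (f : E → ℝ) (R : E ≃ₗᵢ[ℝ] E) (x : E) :
    Δ (f ∘ R) x = Δ f (R x) := by
  rw [laplacian_eq_iteratedFDeriv_orthonormalBasis f ((stdOrthonormalBasis ℝ E).map R),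
    laplacian_eq_iteratedFDeriv_stdOrthonormalBasis]
  refine Finset.sum_congr rfl fun i _ => ?_
  have := R.toContinuousLinearEquiv.iteratedFDerivWithin_comp_right (i := 2) f
    uniqueDiffOn_univ (x := x) (mem_univ _)
  simp only [preimage_univ, iteratedFDerivWithin_univ] at this
  have h2 : f ∘ R = f ∘ R.toContinuousLinearEquiv := rfl
  rw [h2, this, ContinuousMultilinearMap.compContinuousLinearMap_apply]
  congr 1
  ext j
  fin_cases j <;> rfl

/-- Maximum principle on the exterior of the unit ball, for functions decaying at infinity. -/
theorem le_of_harmonic_exterior [Nontrivial E] {v : E → ℝ}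
    (hc : ContinuousOn v {x | 1 ≤ ‖x‖})
    (hv : ∀ x, 1 < ‖x‖ → HarmonicAt v x) {B : ℝ} (hB : ∀ x, 2 ≤ ‖x‖ → v x ≤ B / ‖x‖)
    {K : ℝ} (hK : 0 ≤ K) (hS : ∀ x, ‖x‖ = 1 → v x ≤ K) {p : E} (hp : 1 ≤ ‖p‖) : v p ≤ K := by
  by_contra! hlt
  set δ := v p - K with hδ
  have hδ0 : 0 < δ := sub_pos.2 hlt
  obtain ⟨ρ, hρ⟩ : ∃ ρ : ℝ, ρ ≥ max 2 ‖p‖ ∧ B / ρ < δ / 2 := by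
    have h1 : Tendsto (fun ρ : ℝ => B / ρ) atTop (𝓝 0) := tendsto_const_nhds.div_atTop tendsto_id
    exact ((eventually_ge_atTop _).and (h1.eventually (gt_mem_nhds (half_pos hδ0)))).exists
  obtain ⟨hρ1, hρ2⟩ := hρ
  have hρ3 : 2 ≤ ρ := (le_max_left _ _).trans hρ1
  have hρ4 : ‖p‖ ≤ ρ := (le_max_right _ _).trans hρ1
  set ε := δ / (4 * ρ ^ 2) with hε
  have hρpos : 0 < ρ := by linarith
  have hε0 : 0 < ε := by positivity
  have hερ : ε * ρ ^ 2 = δ / 4 := by rw [hε]; field_simp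
  set φ : E → ℝ := v + ε • fun x : E => ‖x‖ ^ 2 with hφ
  have hφx : ∀ x, φ x = v x + ε * ‖x‖ ^ 2 := fun x => by simp [hφ]
  set A : Set E := {x | 1 ≤ ‖x‖} ∩ Metric.closedBall 0 ρ with hA
  have hAc : IsCompact A :=
    (isCompact_closedBall (0 : E) ρ).inter_left (isClosed_le continuous_const continuous_norm)
  have hpA : p ∈ A := ⟨hp, by simpa using hρ4⟩
  have hφc : ContinuousOn φ A := by
    refine (hc.mono inter_subset_left).add ?_
    exact Continuous.continuousOn (by fun_prop)
  obtain ⟨q, hqA, hq⟩ := hAc.exists_isMaxOn ⟨p, hpA⟩ hφc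
  have hpq : φ p ≤ φ q := hq hpA
  have hφp : K + δ < φ p := by
    have : 0 < ε * ‖p‖ ^ 2 := by positivity
    rw [hφx]; linarith
  have hq1 : 1 ≤ ‖q‖ := hqA.1
  have hqρ : ‖q‖ ≤ ρ := by simpa using hqA.2
  have hq_sq : ε * ‖q‖ ^ 2 ≤ δ / 4 := by
    rw [← hερ]; gcongr
  have hq1' : 1 < ‖q‖ := by
    refine lt_of_le_of_ne hq1 fun h => ?_
    have := hS q h.symm
    rw [hφx q] at hpq
    linarith
  have hqρ' : ‖q‖ < ρ := by
    refine lt_of_le_of_ne hqρ fun h => ?_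
    have := hB q (by linarith)
    rw [h] at this
    rw [hφx q] at hpq
    linarith
  have hmem : A ∈ 𝓝 q := by
    refine inter_mem ?_ (Metric.closedBall_mem_nhds_of_mem (by simpa using hqρ'))
    exact mem_of_superset ((isOpen_lt continuous_const continuous_norm).mem_nhds hq1')
      fun x (hx : 1 < ‖x‖) => hx.le
  have hsq : ContDiffAt ℝ 2 (fun x : E => ‖x‖ ^ 2) q := (contDiff_norm_sq ℝ).contDiffAt
  have hεsq : ContDiffAt ℝ 2 (ε • fun x : E => ‖x‖ ^ 2) q := contDiffAt_const.smul hsq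
  have hvq := hv q hq1'
  have hle : Δ φ q ≤ 0 := laplacian_nonpos_of_isLocalMax (hvq.1.add hεsq) (hq.isLocalMax hmem)
  have hΔ : Δ φ q = ε * (2 * finrank ℝ E) := by
    rw [hφ, hvq.1.laplacian_add hεsq, hvq.2.eq_of_nhds,
      laplacian_smul ε hsq, laplacian_norm_sq]
    simp
  have hdim : (0 : ℝ) < finrank ℝ E := by exact_mod_cast finrank_pos
  have : 0 < Δ φ q := by rw [hΔ]; positivity
  exact absurd hle (not_le.2 this)

theorem exists_norm_eq_and_inner_eq_zero (hE : 1 < finrank ℝ E) (x : E) :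
    ∃ e : E, ‖e‖ = ‖x‖ ∧ ⟪x, e⟫ = 0 := by
  have h1 := (ℝ ∙ x).finrank_add_finrank_orthogonal
  have h2 := finrank_span_le_card (R := ℝ) {x}
  simp only [toFinset_singleton, Finset.card_singleton] at h2
  have : Nontrivial (ℝ ∙ x)ᗮ := nontrivial_of_finrank_pos (R := ℝ) (by omega)
  obtain ⟨e, he⟩ := exists_norm_eq (ℝ ∙ x)ᗮ (norm_nonneg x)
  exact ⟨e, he, Submodule.mem_orthogonal_singleton_iff_inner_right.1 e.2⟩

theorem abs_sub_le_of_norm_eq (hE : 1 < finrank ℝ E) {u : E → ℝ}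
    (hu : ∀ x, 1 < ‖x‖ → DifferentiableAt ℝ u x) {C : ℝ} (hC : 0 ≤ C)
    (hgrad : ∀ x, 1 ≤ ‖x‖ → ‖gradient u x‖ ≤ C / ‖x‖ ^ 2) {x y : E} (hx : 2 ≤ ‖x‖)
    (hxy : ‖x‖ = ‖y‖) : |u x - u y| ≤ 8 * C / ‖x‖ := by
  have key : ∀ e : E, ‖e‖ = ‖x‖ → ⟪x, e⟫ = 0 → 0 ≤ ⟪e, y⟫ → |u x - u y| ≤ 8 * C / ‖x‖ := by
    intro e he h1 h2
    have h3 := abs_sub_le_of_inner_nonneg hu hC hgrad hx he.symm h1.ge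
    have h4 := abs_sub_le_of_inner_nonneg hu hC hgrad (he ▸ hx) (he.trans hxy) h2
    rw [he] at h4
    calc |u x - u y| ≤ |u x - u e| + |u e - u y| := abs_sub_le _ _ _
      _ ≤ 4 * C / ‖x‖ + 4 * C / ‖x‖ := add_le_add h3 h4
      _ = 8 * C / ‖x‖ := by ring
  obtain ⟨e, he, hxe⟩ := exists_norm_eq_and_inner_eq_zero hE x
  rcases le_total 0 ⟪e, y⟫ with h | h
  · exact key e he hxe h
  · exact key (-e) (by simpa using he) (by simpa using hxe) (by simpa using h)

/-- Maximum principle for the difference of a harmonic function and its rotation. -/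
theorem sub_le_of_harmonic_exterior (hE : 1 < finrank ℝ E) {u : E → ℝ}
    (hc : ContinuousOn u {x | 1 ≤ ‖x‖}) (hu : ∀ x, 1 < ‖x‖ → HarmonicAt u x)
    {C : ℝ} (hC : 0 ≤ C) (hgrad : ∀ x, 1 ≤ ‖x‖ → ‖gradient u x‖ ≤ C / ‖x‖ ^ 2)
    {K : ℝ} (hK : 0 ≤ K) (hS : ∀ x y, ‖x‖ = 1 → ‖y‖ = 1 → u x - u y ≤ K)
    (R : E ≃ₗᵢ[ℝ] E) {x : E} (hx : 1 ≤ ‖x‖) : u (R x) - u x ≤ K := by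
  have : Nontrivial E := nontrivial_of_finrank_pos (R := ℝ) (by omega)
  have hdiff : ∀ x, 1 < ‖x‖ → DifferentiableAt ℝ u x := fun x hx =>
    (hu x hx).1.differentiableAt (by simp)
  have hR : ∀ x, 1 < ‖x‖ → HarmonicAt (u ∘ R) x := by
    intro x hx
    refine ⟨ContDiffAt.comp x (hu (R x) (by simpa using hx)).1
      R.toContinuousLinearEquiv.contDiff.contDiffAt, ?_⟩
    filter_upwards [(isOpen_lt continuous_const continuous_norm).mem_nhds hx] with y hy
    rw [laplacian_comp_linearIsometryEquiv, (hu (R y) (by simpa using hy)).2.eq_of_nhds]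
    rfl
  refine le_of_harmonic_exterior (v := u ∘ R - u) ?_ (fun x hx => (hR x hx).sub (hu x hx))
    (B := 8 * C) ?_ hK ?_ hx
  · exact (hc.comp R.continuous.continuousOn fun x hx => by simpa using hx).sub hc
  · intro x hx
    have := abs_sub_le_of_norm_eq hE hdiff hC hgrad (x := R x) (y := x) (by simpa using hx)
      (by simp)
    simpa using (le_abs_self _).trans this
  · intro x hx
    exact hS (R x) x (by simpa using hx) hx

end

/-- Proposition 6.1: a harmonic function on the exterior of the unit ball with
gradient `O(‖x‖⁻²)` and Hessian `O(‖x‖⁻³)`, such that `∂_r u − u` is constant on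
the unit sphere (vanishing tangential derivatives of the viscous stress), must be
a radial function on the closed exterior region. -/
theorem exterior_harmonic_radial_of_tangential_stress
    (u : EuclideanSpace ℝ (Fin 3) → ℝ)
    (hreg : ContDiffOn ℝ 2 u {x : EuclideanSpace ℝ (Fin 3) | 1 ≤ ‖x‖})
    (hharm : ∀ x : EuclideanSpace ℝ (Fin 3), 1 < ‖x‖ → laplacian u x = 0)
    (C : ℝ) (hC : 0 < C)
    (hgrad : ∀ x : EuclideanSpace ℝ (Fin 3), 1 ≤ ‖x‖ →
      ‖gradient u x‖ ≤ C / ‖x‖ ^ 2)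
    (hhess : ∀ x : EuclideanSpace ℝ (Fin 3), 1 ≤ ‖x‖ →
      ‖fderiv ℝ (fderiv ℝ u) x‖ ≤ C / ‖x‖ ^ 3)
    (c : ℝ)
    (hbdry : ∀ x : EuclideanSpace ℝ (Fin 3), ‖x‖ = 1 →
      ⟪x, gradient u x⟫ - u x = c) :
    ∃ g : ℝ → ℝ, ∀ x : EuclideanSpace ℝ (Fin 3), 1 ≤ ‖x‖ → u x = g ‖x‖ := by
  have hE : 1 < Module.finrank ℝ (EuclideanSpace ℝ (Fin 3)) := by simp
  have hnhds : ∀ x : EuclideanSpace ℝ (Fin 3), 1 < ‖x‖ →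
      {x : EuclideanSpace ℝ (Fin 3) | 1 ≤ ‖x‖} ∈ 𝓝 x := fun x hx =>
    mem_of_superset ((isOpen_lt continuous_const continuous_norm).mem_nhds hx)
      fun y (hy : 1 < ‖y‖) => hy.le
  have hcd : ∀ x : EuclideanSpace ℝ (Fin 3), 1 < ‖x‖ → ContDiffAt ℝ 2 u x := fun x hx =>
    hreg.contDiffAt (hnhds x hx)
  have hu : ∀ x : EuclideanSpace ℝ (Fin 3), 1 < ‖x‖ → InnerProductSpace.HarmonicAt u x := by
    intro x hx
    refine ⟨hcd x hx, ?_⟩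
    filter_upwards [(isOpen_lt continuous_const continuous_norm).mem_nhds hx] with y hy
    rw [← laplacian_eq_of_contDiffAt (hcd y hy), hharm y hy]
    rfl
  set s : Set (EuclideanSpace ℝ (Fin 3)) := {x | 1 ≤ ‖x‖}
  set S : Set (EuclideanSpace ℝ (Fin 3)) := Metric.sphere 0 1 with hSdef
  have hmemS : ∀ x, x ∈ S ↔ ‖x‖ = 1 := fun x => by simp [hSdef]
  have hSs : S ⊆ s := fun x hx => ((hmemS x).1 hx).ge
  have huc : ContinuousOn u S := hreg.continuousOn.mono hSs
  let D : EuclideanSpace ℝ (Fin 3) → ℝ := fun x => fderivWithin ℝ u s x x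
  have hDc : ContinuousOn D S :=
    ((hreg.continuousOn_fderivWithin uniqueDiffOn_exterior (by simp)).clm_apply
      continuousOn_id).mono hSs
  have hD : ∀ x ∈ S, D x - u x = c ∨ u x = -c := by
    intro x hx
    have hb := hbdry x ((hmemS x).1 hx)
    by_cases hdx : DifferentiableAt ℝ u x
    · left
      rw [← hb]
      simp only [D]
      rw [hdx.fderivWithin (uniqueDiffOn_exterior x (hSs hx)), real_inner_comm,
        ← InnerProductSpace.toDual_apply_apply (𝕜 := ℝ), toDual_gradient]
    · right
      rw [gradient_eq_zero_of_not_differentiableAt hdx, inner_zero_right] at hb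
      linarith
  have hrank : 1 < Module.rank ℝ (EuclideanSpace ℝ (Fin 3)) := by
    rw [← Module.finrank_eq_rank]
    exact_mod_cast hE
  have hSpre : IsPreconnected S := isPreconnected_sphere hrank 0 1
  have hSc : IsCompact S := isCompact_sphere 0 1
  have hSne : S.Nonempty := ⟨EuclideanSpace.single 0 1, by simp [hmemS]⟩
  obtain ⟨y₀, hy₀, hmax⟩ := hSc.exists_isMaxOn hSne huc
  obtain ⟨x₀, hx₀, hmin⟩ := hSc.exists_isMinOn hSne huc
  have hosc : ∀ x y, ‖x‖ = 1 → ‖y‖ = 1 → u x - u y ≤ u y₀ - u x₀ := fun x y hx hy =>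
    sub_le_sub (hmax ((hmemS x).2 hx)) (hmin ((hmemS y).2 hy))
  have hle : u y₀ ≤ u x₀ := by
    rcases eq_or_exists_eq_of_preconnected hSpre huc hDc hD hy₀ with h | ⟨y, hy, huy, hDy⟩
    · exact (h x₀ hx₀).ge
    rcases eq_or_exists_eq_of_preconnected hSpre huc hDc hD hx₀ with h | ⟨x, hx, hux, hDx⟩
    · exact (h y₀ hy₀).le
    have hx1 := (hmemS x).1 hx
    have hy1 := (hmemS y).1 hy
    have hnorm : ‖x‖ = ‖y‖ := hx1.trans hy1.symm
    set R := (ℝ ∙ (x - y))ᗮ.reflection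
    have hRx : R x = y := Submodule.reflection_sub hnorm
    have hrad : ∀ z ∈ S, HasDerivWithinAt (fun t : ℝ => u (t • z)) (D z) (Set.Ici 1) 1 :=
      fun z hz => hasDerivWithinAt_radial ((hmemS z).1 hz)
        ((hreg.differentiableOn (by simp)) z (hSs hz)).hasFDerivWithinAt
    have := ((hrad y hy).sub (hrad x hx)).nonpos_of_forall_le fun t ht => by
      have htx : 1 ≤ ‖t • x‖ := by
        rw [norm_smul, hx1, mul_one]
        exact le_trans ht (le_abs_self t)
      have := sub_le_of_harmonic_exterior hE hreg.continuousOn hu hC.le hgrad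
        (sub_nonneg.2 (hmax hx₀)) hosc R htx
      simpa [hRx, huy, hux] using this
    linarith
  have hle' : ∀ x y : EuclideanSpace ℝ (Fin 3), 1 ≤ ‖x‖ → ‖x‖ = ‖y‖ → u y ≤ u x := by
    intro x y hx hxy
    have := sub_le_of_harmonic_exterior hE hreg.continuousOn hu hC.le hgrad le_rfl
      (fun x y hx hy => (hosc x y hx hy).trans (sub_nonpos.2 hle))
      (ℝ ∙ (x - y))ᗮ.reflection hx
    rw [Submodule.reflection_sub hxy] at this
    linarith
  refine ⟨fun r => u (r • EuclideanSpace.single 0 1), fun x hx => ?_⟩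
  have hn : ‖x‖ = ‖‖x‖ • (EuclideanSpace.single 0 1 : EuclideanSpace ℝ (Fin 3))‖ := by
    simp [norm_smul]
  exact le_antisymm (hle' _ _ (hn ▸ hx) hn.symm) (hle' _ _ hx hn)
end
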